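/- For every n ≥ 1, the chain complex (ℤΣ_*, ∂) is exact at ℤΣ_{n+1}: the kernel of ∂ : ℤΣ_{n+1} → ℤΣ_n equals the image of ∂ : ℤΣ_{n+2} → ℤΣ_{n+1}. -/

import Mathlib

open Equiv

/-- The `j`-th face of a permutation of `Fin (n+1)`: delete the entry `σ j` from the
one-line notation and decrease by one every remaining entry exceeding `σ j`. -/
def permFace {n : ℕ} (σ : Equiv.Perm (Fin (n + 1))) (j : Fin (n + 1)) :
    Equiv.Perm (Fin n) :=
  (finSuccAboveEquiv j).trans
    ((σ.subtypeEquiv (fun a => (σ.injective.ne_iff (x := a) (y := j)).symm)).trans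
      (finSuccAboveEquiv (σ j)).symm)

/-- The hat `σ̂ ∈ Σ_{n+1}` of `σ ∈ Σ_n`: `σ̂ 0 = 0` and `σ̂ (j+1) = σ j + 1`. -/
def permHat {n : ℕ} (σ : Equiv.Perm (Fin n)) : Equiv.Perm (Fin (n + 1)) :=
  (finSuccEquiv n).symm.permCongr σ.optionCongr

/-- The alternating-sum boundary map `∂ : ℤΣ_{n+1} → ℤΣ_n`. -/
def permBdry (n : ℕ) :
    FreeAbelianGroup (Equiv.Perm (Fin (n + 1))) →+ FreeAbelianGroup (Equiv.Perm (Fin n)) :=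
  FreeAbelianGroup.lift fun σ =>
    ∑ j : Fin (n + 1), (-1 : ℤ) ^ (j : ℕ) • FreeAbelianGroup.of (permFace σ j)

/-- The linear extension `D : ℤΣ_n → ℤΣ_{n+1}` of the hat operation. -/
def permHatMap (n : ℕ) :
    FreeAbelianGroup (Equiv.Perm (Fin n)) →+ FreeAbelianGroup (Equiv.Perm (Fin (n + 1))) :=
  FreeAbelianGroup.lift fun σ => FreeAbelianGroup.of (permHat σ)

/-- The number of orbits (cycles, counting fixed points) of a permutation of `Fin m`. -/
def permCyc {m : ℕ} (π : Equiv.Perm (Fin m)) : ℕ :=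
  π.cycleType.card + (Finset.univ.filter fun x => π x = x).card

/-- The genus `S_2(σ) = (m − Cyc(c_m σ⁻¹ c_m⁻¹ σ))/2` of `σ ∈ Σ_m`. -/
def permS2 {m : ℕ} (σ : Equiv.Perm (Fin m)) : ℕ :=
  (m - permCyc (finRotate m * σ⁻¹ * (finRotate m)⁻¹ * σ)) / 2

/-- The genus `S_1(σ) = ((m+1) − Cyc(c_{m+1} σ̂⁻¹ c_{m+1}⁻¹ σ̂))/2` of `σ ∈ Σ_m`. -/
def permS1 {m : ℕ} (σ : Equiv.Perm (Fin m)) : ℕ :=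
  ((m + 1) -
    permCyc (finRotate (m + 1) * (permHat σ)⁻¹ * (finRotate (m + 1))⁻¹ * permHat σ)) / 2

theorem succAbove_permFace {n : ℕ} (σ : Equiv.Perm (Fin (n + 1))) (j : Fin (n + 1)) (i : Fin n) :
    (σ j).succAbove (permFace σ j i) = σ (j.succAbove i) :=
  congrArg Subtype.val ((finSuccAboveEquiv (σ j)).apply_symm_apply
    ((σ.subtypeEquiv (fun a => (σ.injective.ne_iff (x := a) (y := j)).symm))
      (finSuccAboveEquiv j i)))

theorem permHat_zero {n : ℕ} (σ : Equiv.Perm (Fin n)) : permHat σ 0 = 0 := by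
  simp [permHat, Equiv.permCongr_apply]

theorem permHat_succ {n : ℕ} (σ : Equiv.Perm (Fin n)) (i : Fin n) :
    permHat σ i.succ = (σ i).succ := by
  simp [permHat, Equiv.permCongr_apply]

theorem permFace_permHat_zero {n : ℕ} (σ : Equiv.Perm (Fin n)) : permFace (permHat σ) 0 = σ := by
  ext1 i
  apply Fin.succAbove_right_injective (p := permHat σ 0)
  rw [succAbove_permFace, permHat_zero, Fin.zero_succAbove, Fin.zero_succAbove, permHat_succ]

theorem permFace_permHat_succ {n : ℕ} (σ : Equiv.Perm (Fin (n + 1))) (j : Fin (n + 1)) :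
    permFace (permHat σ) j.succ = permHat (permFace σ j) := by
  ext1 i
  apply Fin.succAbove_right_injective (p := permHat σ j.succ)
  rw [succAbove_permFace, permHat_succ]
  cases i using Fin.cases with
  | zero => simp [permHat_zero]
  | succ i => rw [Fin.succ_succAbove_succ, permHat_succ, permHat_succ, Fin.succ_succAbove_succ,
      succAbove_permFace]

theorem permFace_permFace {n : ℕ} (σ : Equiv.Perm (Fin (n + 2))) (i : Fin (n + 2))
    (j : Fin (n + 1)) :
    permFace (permFace σ (i.succAbove j)) (j.predAbove i) = permFace (permFace σ i) j := by
  have hb : σ (i.succAbove j) = (σ i).succAbove (permFace σ i j) := (succAbove_permFace σ i j).symm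
  have hb' : permFace σ (i.succAbove j) (j.predAbove i) = (permFace σ i j).predAbove (σ i) := by
    apply Fin.succAbove_right_injective (p := σ (i.succAbove j))
    rw [succAbove_permFace, Fin.succAbove_succAbove_predAbove, hb,
      Fin.succAbove_succAbove_predAbove]
  ext1 k
  apply Fin.succAbove_right_injective (p := permFace σ i j)
  apply Fin.succAbove_right_injective (p := σ i)
  rw [succAbove_permFace, succAbove_permFace, ← Fin.succAbove_succAbove_succAbove_predAbove,
    ← hb, ← hb', succAbove_permFace, succAbove_permFace,
    Fin.succAbove_succAbove_succAbove_predAbove]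

theorem permBdry_of {n : ℕ} (σ : Equiv.Perm (Fin (n + 1))) :
    permBdry n (FreeAbelianGroup.of σ) =
      ∑ j : Fin (n + 1), (-1 : ℤ) ^ (j : ℕ) • FreeAbelianGroup.of (permFace σ j) :=
  FreeAbelianGroup.lift_apply_of _ _

theorem permHatMap_of {n : ℕ} (σ : Equiv.Perm (Fin n)) :
    permHatMap n (FreeAbelianGroup.of σ) = FreeAbelianGroup.of (permHat σ) :=
  FreeAbelianGroup.lift_apply_of _ _

theorem permBdry_permBdry {n : ℕ} (x : FreeAbelianGroup (Equiv.Perm (Fin (n + 2)))) :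
    permBdry n (permBdry (n + 1) x) = 0 := by
  suffices h : (permBdry n).comp (permBdry (n + 1)) = 0 from DFunLike.congr_fun h x
  ext σ
  simp only [AddMonoidHom.comp_apply, permBdry_of, map_sum, map_zsmul, Finset.smul_sum,
    smul_smul, AddMonoidHom.zero_apply, ← pow_add, ← Finset.sum_product']
  refine Finset.sum_involution (fun p _ => (p.1.succAbove p.2, p.2.predAbove p.1))
    (fun p _ => ?_) (fun p _ _ h => ?_) (fun _ _ => by simp) (fun p _ => ?_)
  · rw [permFace_permFace, Fin.neg_one_pow_succAbove_add_predAbove, ← add_smul]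
    simp
  · exact Fin.succAbove_ne _ _ (congrArg Prod.fst h)
  · simp [Fin.succAbove_succAbove_predAbove, Fin.predAbove_predAbove_succAbove]

theorem permBdry_permHatMap {n : ℕ} (x : FreeAbelianGroup (Equiv.Perm (Fin (n + 1)))) :
    permBdry (n + 1) (permHatMap (n + 1) x) = x - permHatMap n (permBdry n x) := by
  suffices h : (permBdry (n + 1)).comp (permHatMap (n + 1)) =
      AddMonoidHom.id _ - (permHatMap n).comp (permBdry n) from DFunLike.congr_fun h x
  ext σ
  simp [permBdry_of, permHatMap_of, Fin.sum_univ_succ (n := n + 1), permFace_permHat_zero,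
    permFace_permHat_succ, pow_succ, sub_eq_add_neg, map_zsmul, -zsmul_eq_mul]

/-- For every `n ≥ 1`, the chain complex `(ℤΣ_*, ∂)` is exact at `ℤΣ_{n+1}`:
the kernel of `∂ : ℤΣ_{n+1} → ℤΣ_n` equals the image of `∂ : ℤΣ_{n+2} → ℤΣ_{n+1}`. -/
theorem bdry_exact (n : ℕ) (hn : 1 ≤ n)
    (x : FreeAbelianGroup (Equiv.Perm (Fin (n + 1)))) :
    permBdry n x = 0 ↔ ∃ y, permBdry (n + 1) y = x := by
  constructor
  · intro h
    exact ⟨permHatMap (n + 1) x, by rw [permBdry_permHatMap, h, map_zero, sub_zero]⟩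
  · rintro ⟨y, rfl⟩
    exact permBdry_permBdry y
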